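/- Let G be a Θ2-graph of order n ≥ 12. Then Sz*(G) < (n³ + 2n² − 18)/4. -/

import Mathlib

attribute [local instance] Classical.propDecidable

noncomputable def nC {V : Type*} [Fintype V] (G : SimpleGraph V) (u v : V) : ℕ :=
  (Finset.univ.filter fun w => G.dist u w < G.dist v w).card

noncomputable def nE {V : Type*} [Fintype V] (G : SimpleGraph V) (u v : V) : ℕ :=
  (Finset.univ.filter fun w => G.dist u w = G.dist v w).card

lemma nE_comm {V : Type*} [Fintype V] (G : SimpleGraph V) (u v : V) :
    nE G u v = nE G v u := by
  unfold nE; congr 1; ext w; simp [eq_comm]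

noncomputable def szContrib {V : Type*} [Fintype V] (G : SimpleGraph V) : Sym2 V → ℚ :=
  Sym2.lift ⟨fun u v =>
    ((nC G u v : ℚ) + (nE G u v : ℚ) / 2) * ((nC G v u : ℚ) + (nE G u v : ℚ) / 2),
    fun u v => by dsimp only; rw [nE_comm]; ring⟩

noncomputable def revSz {V : Type*} [Fintype V] (G : SimpleGraph V) : ℚ :=
  ∑ e ∈ G.edgeFinset, szContrib G e
/-- Two paths are internally disjoint if every common vertex is an endpoint of both. -/
def IntDisj {V : Type*} {G : SimpleGraph V} {x y x' y' : V}
    (P : G.Walk x y) (Q : G.Walk x' y') : Prop :=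
  ∀ v : V, v ∈ P.support → v ∈ Q.support → (v = x ∨ v = y) ∧ (v = x' ∨ v = y')
/-- `G` consists of the three distinct vertices `x, y, z`, two internally disjoint
paths `Q₁, Q₂` joining `x` and `y`, two internally disjoint paths `R₁, R₂` joining
`x` and `z`, and a path `S` joining `y` and `z`, all pairwise internally disjoint,
every vertex and every edge of `G` lying on one of these paths. -/
def Theta2Cond {V : Type*} (G : SimpleGraph V) (x y z : V)
    (Q₁ Q₂ : G.Walk x y) (R₁ R₂ : G.Walk x z) (S : G.Walk y z) : Prop :=
  x ≠ y ∧ x ≠ z ∧ y ≠ z ∧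
  Q₁.IsPath ∧ Q₂.IsPath ∧ R₁.IsPath ∧ R₂.IsPath ∧ S.IsPath ∧
  Q₁ ≠ Q₂ ∧ R₁ ≠ R₂ ∧
  IntDisj Q₁ Q₂ ∧ IntDisj Q₁ R₁ ∧ IntDisj Q₁ R₂ ∧ IntDisj Q₁ S ∧
  IntDisj Q₂ R₁ ∧ IntDisj Q₂ R₂ ∧ IntDisj Q₂ S ∧
  IntDisj R₁ R₂ ∧ IntDisj R₁ S ∧ IntDisj R₂ S ∧
  (∀ v : V, v ∈ Q₁.support ∨ v ∈ Q₂.support ∨ v ∈ R₁.support ∨ v ∈ R₂.support ∨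
    v ∈ S.support) ∧
  (∀ e ∈ G.edgeSet, e ∈ Q₁.edges ∨ e ∈ Q₂.edges ∨ e ∈ R₁.edges ∨ e ∈ R₂.edges ∨
    e ∈ S.edges)

/-- `G` is a Θ₂-graph. -/
def IsTheta2 {V : Type*} (G : SimpleGraph V) : Prop :=
  ∃ (x y z : V) (Q₁ Q₂ : G.Walk x y) (R₁ R₂ : G.Walk x z) (S : G.Walk y z),
    Theta2Cond G x y z Q₁ Q₂ R₁ R₂ S

section BalanceArithmetic

/-- The total change of the profile `i ↦ min (A + i) (B + (L - i))` over `0 < i < L` when the end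
values change by `e` and `f`, where `t = B - A + L`. -/
def sig (L t e f : ℤ) : ℤ :=
  if e = 1 then (if f = 1 then L - 1 else if f = 0 then (t - 1) / 2 else t - 1 - L)
  else if e = 0 then
    (if f = 1 then (2 * L - t - 1) / 2 else if f = 0 then 0 else -((2 * L - t) / 2))
  else (if f = 1 then L - 1 - t else if f = 0 then -(t / 2) else 1 - L)

/-- The difference of the transmissions at the ends of an edge at `x`, in terms of the lengths of
the paths not containing this edge, the distances `p`, `q` from `x` to `y`, `z`, and the changes
`e`, `f` of these distances along the edge. -/
def bal (a' b b' c p q e f : ℤ) : ℤ :=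
  1 + f - p + sig a' (p + a') 1 e + sig b (q + b) 1 f + sig b' (q + b') 1 f +
    sig c (q - p + c) e f

lemma bal_cases {e f : ℤ} (he : e = -1 ∨ e = 0 ∨ e = 1) (hf : f = -1 ∨ f = 0 ∨ f = 1)
    (a' b b' c p q : ℤ) :
    (e = -1 ∧ f = -1 ∧ bal a' b b' c p q e f = 1 - 1 - p + (p - 1) + (q - 1) + (q - 1) + (1 - c)) ∨
    (e = -1 ∧ f = 0 ∧ bal a' b b' c p q e f =
      1 - p + (p - 1) + (q + b - 1) / 2 + (q + b' - 1) / 2 - ((q - p + c) / 2)) ∨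
    (e = -1 ∧ f = 1 ∧ bal a' b b' c p q e f =
      1 + 1 - p + (p - 1) + (b - 1) + (b' - 1) + (p - q - 1)) ∨
    (e = 0 ∧ f = -1 ∧ bal a' b b' c p q e f =
      1 - 1 - p + (p + a' - 1) / 2 + (q - 1) + (q - 1) - ((c + p - q) / 2)) ∨
    (e = 0 ∧ f = 0 ∧ bal a' b b' c p q e f =
      1 - p + (p + a' - 1) / 2 + (q + b - 1) / 2 + (q + b' - 1) / 2 + 0) ∨
    (e = 0 ∧ f = 1 ∧ bal a' b b' c p q e f =
      1 + 1 - p + (p + a' - 1) / 2 + (b - 1) + (b' - 1) + (c + p - q - 1) / 2) ∨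
    (e = 1 ∧ f = -1 ∧ bal a' b b' c p q e f =
      1 - 1 - p + (a' - 1) + (q - 1) + (q - 1) + (q - p - 1)) ∨
    (e = 1 ∧ f = 0 ∧ bal a' b b' c p q e f =
      1 - p + (a' - 1) + (q + b - 1) / 2 + (q + b' - 1) / 2 + (q - p + c - 1) / 2) ∨
    (e = 1 ∧ f = 1 ∧ bal a' b b' c p q e f =
      1 + 1 - p + (a' - 1) + (b - 1) + (b' - 1) + (c - 1)) := by
  rcases he with rfl | rfl | rfl <;> rcases hf with rfl | rfl | rfl <;> simp [bal, sig] <;> ring_nf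

set_option maxHeartbeats 4000000 in
lemma nine_le_bal_of_balanced {a a' b b' c : ℤ} (ha : 1 ≤ a) (haa : a ≤ a') (ha' : 2 ≤ a')
    (hb : 1 ≤ b) (hbb : b ≤ b') (hb' : 2 ≤ b') (hc : 1 ≤ c) (hab : a ≤ b + c) (hba : b ≤ a + c)
    (hn : 14 ≤ a + a' + b + b' + c) (h2 : ¬ (a = 2 ∧ a' = 2 ∧ b = 2 ∧ b' = 2)) :
    9 ≤ bal a' b b' c a b (-1) (min 1 (a - 1 + c - b)) +
      bal a b b' c a b (min 1 (a' - 1 - a)) (min 1 (a' - 1 + c - b)) +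
      bal b' a a' c b a (-1) (min 1 (b - 1 + c - a)) +
      bal b a a' c b a (min 1 (b' - 1 - b)) (min 1 (b' - 1 + c - a)) := by
  generalize hf1 : min 1 (a - 1 + c - b) = f1
  generalize he2 : min 1 (a' - 1 - a) = e2
  generalize hf2 : min 1 (a' - 1 + c - b) = f2
  generalize hf3 : min 1 (b - 1 + c - a) = f3
  generalize he4 : min 1 (b' - 1 - b) = e4
  generalize hf4 : min 1 (b' - 1 + c - a) = f4
  have E2 : (e2 = -1 ∧ a' = a) ∨ (e2 = 0 ∧ a' = a + 1) ∨ (e2 = 1 ∧ a' ≥ a + 2) := by omega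
  have E4 : (e4 = -1 ∧ b' = b) ∨ (e4 = 0 ∧ b' = b + 1) ∨ (e4 = 1 ∧ b' ≥ b + 2) := by omega
  have F1 : (f1 = -1 ∧ b = a + c) ∨ (f1 = 0 ∧ b = a + c - 1) ∨ (f1 = 1 ∧ b ≤ a + c - 2) := by omega
  have F3 : (f3 = -1 ∧ a = b + c) ∨ (f3 = 0 ∧ a = b + c - 1) ∨ (f3 = 1 ∧ a ≤ b + c - 2) := by omega
  have F2 : (f2 = -1 ∧ b = a' + c) ∨ (f2 = 0 ∧ b = a' + c - 1) ∨ (f2 = 1 ∧ b ≤ a' + c - 2) := by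
    omega
  have F4 : (f4 = -1 ∧ a = b' + c) ∨ (f4 = 0 ∧ a = b' + c - 1) ∨ (f4 = 1 ∧ a ≤ b' + c - 2) := by
    omega
  clear hf1 he2 hf2 hf3 he4 hf4
  rcases F1 with ⟨rfl, F1⟩ | ⟨rfl, F1⟩ | ⟨rfl, F1⟩ <;>
  rcases F3 with ⟨rfl, F3⟩ | ⟨rfl, F3⟩ | ⟨rfl, F3⟩ <;> try (exfalso; clear E2 E4 F2 F4; omega)
  all_goals
  rcases E2 with ⟨rfl, E2⟩ | ⟨rfl, E2⟩ | ⟨rfl, E2⟩ <;>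
  rcases F2 with ⟨rfl, F2⟩ | ⟨rfl, F2⟩ | ⟨rfl, F2⟩ <;> try (exfalso; clear E4 F4; omega)
  all_goals
  rcases E4 with ⟨rfl, E4⟩ | ⟨rfl, E4⟩ | ⟨rfl, E4⟩ <;>
  rcases F4 with ⟨rfl, F4⟩ | ⟨rfl, F4⟩ | ⟨rfl, F4⟩ <;> try (exfalso; omega)
  all_goals (simp [bal, sig])
  all_goals (clear hab hba; first | (clear h2; omega) | omega)

lemma nine_le_bal_of_shortcut {a a' b b' c : ℤ} (haa : a ≤ a') (hb : 1 ≤ b) (hbb : b ≤ b')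
    (hb' : 2 ≤ b') (hc : 1 ≤ c) (hab : b + c < a) (hn : 14 ≤ a + a' + b + b' + c) :
    9 ≤ bal a' b b' c (b + c) b (min 1 (a - 1 - (b + c))) (min 1 (a - 1 + c - b)) +
      bal a b b' c (b + c) b (min 1 (a' - 1 - (b + c))) (min 1 (a' - 1 + c - b)) +
      bal b' a a' c b (b + c) (-1) (min 1 (b - 1 + c - (b + c))) +
      bal b a a' c b (b + c) (min 1 (b' - 1 - b)) (min 1 (b' - 1 + c - (b + c))) := by
  have E1 : min 1 (a - 1 + c - b) = 1 := by omega
  have E2 : min 1 (a' - 1 + c - b) = 1 := by omega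
  have E3 : min 1 (b - 1 + c - (b + c)) = -1 := by omega
  have E4 : b' - 1 + c - (b + c) = b' - 1 - b := by ring
  rw [E1, E2, E3, E4]
  generalize hf1 : min 1 (a - 1 - (b + c)) = e1
  generalize he2 : min 1 (a' - 1 - (b + c)) = e2
  generalize he4 : min 1 (b' - 1 - b) = e4
  have H1 := bal_cases (e := e1) (f := 1) (by omega) (by omega) a' b b' c (b + c) b
  have H2 := bal_cases (e := e2) (f := 1) (by omega) (by omega) a b b' c (b + c) b
  have H3 := bal_cases (e := -1) (f := -1) (by omega) (by omega) b' a a' c b (b + c)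
  have H4 := bal_cases (e := e4) (f := e4) (by omega) (by omega) b a a' c b (b + c)
  generalize bal a' b b' c (b + c) b e1 1 = T1 at *
  generalize bal a b b' c (b + c) b e2 1 = T2 at *
  generalize bal b' a a' c b (b + c) (-1) (-1) = T3 at *
  generalize bal b a a' c b (b + c) e4 e4 = T4 at *
  norm_num at H3
  rcases (show e1 = 0 ∨ e1 = 1 by omega) with rfl | rfl <;> norm_num at H1 <;>
  rcases (show e2 = 0 ∨ e2 = 1 by omega) with rfl | rfl <;> norm_num at H2 <;>
  rcases (show e4 = -1 ∨ e4 = 0 ∨ e4 = 1 by omega) with rfl | rfl | rfl <;> norm_num at H4 <;> omega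

end BalanceArithmetic

section Distances

open SimpleGraph Finset

/-- `P` is a path whose internal vertices have no neighbours outside their neighbours on `P`. -/
def IsEar {V : Type*} {G : SimpleGraph V} {p q : V} (P : G.Walk p q) : Prop :=
  P.IsPath ∧ ∀ i, 0 < i → i < P.length → ∀ w, G.Adj (P.getVert i) w →
    w = P.getVert (i - 1) ∨ w = P.getVert (i + 1)

/-- `v` is not an internal vertex of `P`. -/
def IsOff {V : Type*} {G : SimpleGraph V} {p q : V} (v : V) (P : G.Walk p q) : Prop :=
  ∀ i, 0 < i → i < P.length → P.getVert i ≠ v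

lemma eq_min_of_descent (g : ℕ → ℕ) (L : ℕ)
    (h1 : ∀ i < L, g i ≤ g (i + 1) + 1 ∧ g (i + 1) ≤ g i + 1)
    (h2 : ∀ i, 0 < i → i < L → g i = g (i - 1) + 1 ∨ g i = g (i + 1) + 1) :
    ∀ i ≤ L, (g i : ℤ) = min ((g 0 : ℤ) + i) (g L + (L - i)) := by
  have up1 : ∀ i ≤ L, g i ≤ g 0 + i := by
    intro i
    induction i with
    | zero => simp
    | succ k ih => intro hk; have := ih (by omega); have := h1 k (by omega); omega
  have up2 : ∀ j ≤ L, g (L - j) ≤ g L + j := by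
    intro j
    induction j with
    | zero => simp
    | succ k ih =>
      intro hk
      have := ih (by omega)
      have := h1 (L - (k + 1)) (by omega)
      rw [show L - (k + 1) + 1 = L - k by omega] at this
      omega
  have low : ∀ m i, i ≤ L → g i = m → g 0 + i ≤ g i ∨ g L + (L - i) ≤ g i := by
    intro m
    induction m using Nat.strong_induction_on with
    | _ m ih =>
      intro i hi hm
      rcases Nat.eq_zero_or_pos i with rfl | hpos
      · left; omega
      rcases hi.eq_or_lt with rfl | hlt
      · right; omega
      rcases h2 i hpos hlt with h | h
      · rcases ih _ (by omega) (i - 1) (by omega) rfl with h' | h' <;> omega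
      · rcases ih _ (by omega) (i + 1) (by omega) rfl with h' | h' <;> omega
  intro i hi
  have a := up1 i hi
  have b := up2 (L - i) (by omega)
  rw [show L - (L - i) = i by omega] at b
  have c := low _ i hi rfl
  omega

variable {V : Type*} {G : SimpleGraph V}

lemma dist_adj_le (hG : G.Connected) (v : V) {a b : V} (h : G.Adj a b) :
    G.dist v a ≤ G.dist v b + 1 ∧ G.dist v b ≤ G.dist v a + 1 := by
  have := hG.dist_triangle (u := v) (v := a) (w := b)
  have := hG.dist_triangle (u := v) (v := b) (w := a)
  have h1 := dist_eq_one_iff_adj.2 h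
  have h2 := dist_eq_one_iff_adj.2 h.symm
  omega

lemma exists_adj_dist_succ (hG : G.Connected) {v w : V} (h : v ≠ w) :
    ∃ u, G.Adj w u ∧ G.dist v w = G.dist v u + 1 := by
  obtain ⟨p, hp⟩ := hG.exists_walk_length_eq_dist w v
  cases p with
  | nil => exact absurd rfl h
  | cons hadj q =>
    refine ⟨_, hadj, ?_⟩
    have h1 := dist_le q
    have h2 := dist_adj_le hG v hadj
    rw [dist_comm (v := v)] at h1
    rw [dist_comm, Walk.length_cons] at hp
    omega

lemma IsEar.dist_getVert (hG : G.Connected) {p q : V} {P : G.Walk p q} (hP : IsEar P) {v : V}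
    (hv : IsOff v P) {i : ℕ} (hi : i ≤ P.length) :
    (G.dist v (P.getVert i) : ℤ) =
      min ((G.dist v p : ℤ) + i) (G.dist v q + (P.length - i)) := by
  have := eq_min_of_descent (fun j => G.dist v (P.getVert j)) P.length
    (fun j hj => dist_adj_le hG v (P.adj_getVert_succ hj)) (fun j h0 hj => by
      obtain ⟨u, hu, hd⟩ := exists_adj_dist_succ hG (hv j h0 hj).symm
      rcases hP.2 j h0 hj u hu with rfl | rfl
      · exact Or.inl hd
      · exact Or.inr hd) i hi
  simpa using this

lemma IsEar.dist_snd_getVert (hG : G.Connected) {p q : V} {P : G.Walk p q} (hP : IsEar P)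
    {i : ℕ} (h0 : 1 ≤ i) (hi : i ≤ P.length) :
    (G.dist (P.getVert 1) (P.getVert i) : ℤ) =
      min ((i : ℤ) - 1) (G.dist (P.getVert 1) q + (P.length - i)) := by
  obtain ⟨j, rfl⟩ := Nat.exists_eq_add_of_le' h0
  have := eq_min_of_descent (fun j => G.dist (P.getVert 1) (P.getVert (j + 1))) (P.length - 1)
    (fun j hj => dist_adj_le hG _ (P.adj_getVert_succ (by omega))) (fun j h0 hj => by
      obtain ⟨u, hu, hd⟩ := exists_adj_dist_succ hG (v := P.getVert 1) (w := P.getVert (j + 1)) (by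
        intro h
        have := hP.1.getVert_injOn (x₁ := 1) (x₂ := j + 1) (by simp; omega) (by simp; omega) h
        omega)
      rcases hP.2 (j + 1) (by omega) (by omega) u hu with rfl | rfl
      · left
        rw [show j - 1 + 1 = j + 1 - 1 by omega]
        exact hd
      · exact Or.inr hd) j (by omega)
  rw [show P.length - 1 + 1 = P.length by omega] at this
  simp only [Walk.getVert_length, Nat.zero_add, SimpleGraph.dist_self] at this
  rw [this]
  push_cast [Nat.cast_sub (show 1 ≤ P.length by omega)]
  omega

end Distances

section Structure

open SimpleGraph Finset

variable {V : Type*} {G : SimpleGraph V} {x y z : V}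
  {Q₁ Q₂ : G.Walk x y} {R₁ R₂ : G.Walk x z} {S : G.Walk y z}

lemma mem_edges_iff_getVert {p q u w : V} (P : G.Walk p q) :
    s(u, w) ∈ P.edges ↔ ∃ i < P.length, s(P.getVert i, P.getVert (i + 1)) = s(u, w) := by
  rw [← Walk.mem_edges_toSubgraph, Subgraph.mem_edgeSet, Walk.toSubgraph_adj_iff]
  tauto

lemma eq_getVert_of_mem_edges {p q u w : V} {P : G.Walk p q} (hP : P.IsPath) {i : ℕ}
    (hi : i ≤ P.length) (hu : P.getVert i = u) (h : s(u, w) ∈ P.edges) :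
    (0 < i ∧ w = P.getVert (i - 1)) ∨ (i < P.length ∧ w = P.getVert (i + 1)) := by
  obtain ⟨j, hj, he⟩ := (mem_edges_iff_getVert P).1 h
  subst hu
  rcases Sym2.eq_iff.1 he with ⟨h1, h2⟩ | ⟨h1, h2⟩
  · have := hP.getVert_injOn (x₁ := j) (x₂ := i) (by simp; omega) (by simp; omega) h1
    subst this
    exact Or.inr ⟨hj, h2.symm⟩
  · have := hP.getVert_injOn (x₁ := j + 1) (x₂ := i) (by simp; omega) (by simp; omega) h2
    subst this
    exact Or.inl ⟨by omega, by simpa using h1.symm⟩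

lemma getVert_ne_of_isPath {p q : V} {P : G.Walk p q} (hP : P.IsPath) {i : ℕ}
    (h0 : 0 < i) (hi : i < P.length) : P.getVert i ≠ p ∧ P.getVert i ≠ q :=
  ⟨fun h => by have := (hP.getVert_eq_start_iff hi.le).1 h; omega,
    fun h => by have := (hP.getVert_eq_end_iff hi.le).1 h; omega⟩

lemma IntDisj.symm {x y x' y' : V} {P : G.Walk x y} {Q : G.Walk x' y'} (h : IntDisj P Q) :
    IntDisj Q P := fun v h1 h2 => (h v h2 h1).symm

lemma IntDisj.reverse {x y x' y' : V} {P : G.Walk x y} {Q : G.Walk x' y'} (h : IntDisj P Q) :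
    IntDisj P Q.reverse := fun v h1 h2 => by
  have := h v h1 (by simpa using h2); tauto

lemma IntDisj.not_mem {x y x' y' v : V} {P : G.Walk x y} {Q : G.Walk x' y'} (h : IntDisj P Q)
    (hx : v ≠ x) (hy : v ≠ y) (hv : v ∈ P.support) : v ∉ Q.support :=
  fun h' => (h v hv h').1.elim hx hy

lemma Theta2Cond.swap (h : Theta2Cond G x y z Q₁ Q₂ R₁ R₂ S) :
    Theta2Cond G x y z Q₂ Q₁ R₁ R₂ S := by
  obtain ⟨hxy, hxz, hyz, p1, p2, p3, p4, p5, n1, n2, d1, d2, d3, d4, d5, d6, d7, d8, d9, d10,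
    hv, he⟩ := h
  refine ⟨hxy, hxz, hyz, p2, p1, p3, p4, p5, n1.symm, n2, d1.symm, d5, d6, d7, d2, d3, d4, d8,
    d9, d10, fun v => ?_, fun e h => ?_⟩
  · have := hv v; tauto
  · have := he e h; tauto

lemma Theta2Cond.flip (h : Theta2Cond G x y z Q₁ Q₂ R₁ R₂ S) :
    Theta2Cond G x z y R₁ R₂ Q₁ Q₂ S.reverse := by
  obtain ⟨hxy, hxz, hyz, p1, p2, p3, p4, p5, n1, n2, d1, d2, d3, d4, d5, d6, d7, d8, d9, d10,
    hv, he⟩ := h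
  refine ⟨hxz, hxy, hyz.symm, p3, p4, p1, p2, p5.reverse, n2, n1, d8, d2.symm, d5.symm,
    d9.reverse, d3.symm, d6.symm, d10.reverse, d1, d4.reverse, d7.reverse,
    fun v => ?_, fun e h => ?_⟩
  · have := hv v; simp only [Walk.support_reverse, List.mem_reverse]; tauto
  · have := he e h; simp only [Walk.edges_reverse, List.mem_reverse]; tauto

lemma isEar_of_unique {p q : V} {P : G.Walk p q} (hP : P.IsPath)
    (h : ∀ u w, u ∈ P.support → u ≠ p → u ≠ q → G.Adj u w → s(u, w) ∈ P.edges) : IsEar P := by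
  refine ⟨hP, fun i h0 hi w hw => ?_⟩
  have hne := getVert_ne_of_isPath hP h0 hi
  have := eq_getVert_of_mem_edges hP hi.le rfl (h _ w (P.getVert_mem_support i) hne.1 hne.2 hw)
  tauto

lemma Theta2Cond.isEar_fst (h : Theta2Cond G x y z Q₁ Q₂ R₁ R₂ S) : IsEar Q₁ := by
  obtain ⟨hxy, hxz, hyz, p1, p2, p3, p4, p5, n1, n2, d1, d2, d3, d4, d5, d6, d7, d8, d9, d10,
    hv, he⟩ := h
  refine isEar_of_unique p1 fun u w hu h1 h2 hw => ?_
  rcases he s(u, w) hw with h | h | h | h | h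
  · exact h
  · have := d1 u hu (Walk.fst_mem_support_of_mem_edges _ h); tauto
  · have := d2 u hu (Walk.fst_mem_support_of_mem_edges _ h); tauto
  · have := d3 u hu (Walk.fst_mem_support_of_mem_edges _ h); tauto
  · have := d4 u hu (Walk.fst_mem_support_of_mem_edges _ h); tauto

lemma Theta2Cond.isEar_link (h : Theta2Cond G x y z Q₁ Q₂ R₁ R₂ S) : IsEar S := by
  obtain ⟨hxy, hxz, hyz, p1, p2, p3, p4, p5, n1, n2, d1, d2, d3, d4, d5, d6, d7, d8, d9, d10,
    hv, he⟩ := h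
  refine isEar_of_unique p5 fun u w hu h1 h2 hw => ?_
  rcases he s(u, w) hw with h | h | h | h | h
  · have := d4 u (Walk.fst_mem_support_of_mem_edges _ h) hu; tauto
  · have := d7 u (Walk.fst_mem_support_of_mem_edges _ h) hu; tauto
  · have := d9 u (Walk.fst_mem_support_of_mem_edges _ h) hu; tauto
  · have := d10 u (Walk.fst_mem_support_of_mem_edges _ h) hu; tauto
  · exact h

lemma connected_of_support {x : V} (h : ∀ v, G.Reachable x v) : G.Connected where
  preconnected u v := (h u).symm.trans (h v)
  nonempty := ⟨x⟩

lemma Theta2Cond.connected (h : Theta2Cond G x y z Q₁ Q₂ R₁ R₂ S) : G.Connected := by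
  obtain ⟨hxy, hxz, hyz, p1, p2, p3, p4, p5, n1, n2, d1, d2, d3, d4, d5, d6, d7, d8, d9, d10,
    hv, he⟩ := h
  refine connected_of_support (x := x) fun v => ?_
  rcases hv v with h | h | h | h | h
  · exact (Q₁.takeUntil v h).reachable
  · exact (Q₂.takeUntil v h).reachable
  · exact (R₁.takeUntil v h).reachable
  · exact (R₂.takeUntil v h).reachable
  · exact Q₁.reachable.trans (S.takeUntil v h).reachable

/-- The neighbours of `y`. -/
lemma Theta2Cond.eq_of_adj_snd (h : Theta2Cond G x y z Q₁ Q₂ R₁ R₂ S) {w : V} (hw : G.Adj y w) :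
    w = Q₁.getVert (Q₁.length - 1) ∨ w = Q₂.getVert (Q₂.length - 1) ∨ w = S.getVert 1 := by
  obtain ⟨hxy, hxz, hyz, p1, p2, p3, p4, p5, n1, n2, d1, d2, d3, d4, d5, d6, d7, d8, d9, d10,
    hv, he⟩ := h
  have key : ∀ Q : G.Walk x y, Q.IsPath → s(y, w) ∈ Q.edges → w = Q.getVert (Q.length - 1) := by
    intro Q hQ h
    have := eq_getVert_of_mem_edges hQ le_rfl Q.getVert_length h
    simp only [lt_self_iff_false, false_and, or_false] at this
    exact this.2
  rcases he s(y, w) hw with h | h | h | h | h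
  · exact Or.inl (key _ p1 h)
  · exact Or.inr (Or.inl (key _ p2 h))
  · have := d2 y Q₁.end_mem_support (Walk.fst_mem_support_of_mem_edges _ h); tauto
  · have := d3 y Q₁.end_mem_support (Walk.fst_mem_support_of_mem_edges _ h); tauto
  · have := eq_getVert_of_mem_edges p5 (Nat.zero_le _) S.getVert_zero h
    simp at this
    tauto

/-- The neighbours of `x`. -/
lemma Theta2Cond.eq_of_adj_fst (h : Theta2Cond G x y z Q₁ Q₂ R₁ R₂ S) {w : V} (hw : G.Adj x w) :
    w = Q₁.getVert 1 ∨ w = Q₂.getVert 1 ∨ w = R₁.getVert 1 ∨ w = R₂.getVert 1 := by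
  obtain ⟨hxy, hxz, hyz, p1, p2, p3, p4, p5, n1, n2, d1, d2, d3, d4, d5, d6, d7, d8, d9, d10,
    hv, he⟩ := h
  have key : ∀ t, ∀ Q : G.Walk x t, Q.IsPath → s(x, w) ∈ Q.edges → w = Q.getVert 1 := by
    intro t Q hQ h
    have := eq_getVert_of_mem_edges hQ (Nat.zero_le _) Q.getVert_zero h
    simp at this
    tauto
  rcases he s(x, w) hw with h | h | h | h | h
  · exact Or.inl (key _ _ p1 h)
  · exact Or.inr (Or.inl (key _ _ p2 h))
  · exact Or.inr (Or.inr (Or.inl (key _ _ p3 h)))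
  · exact Or.inr (Or.inr (Or.inr (key _ _ p4 h)))
  · have := d4 x Q₁.start_mem_support (Walk.fst_mem_support_of_mem_edges _ h); tauto

lemma sum_getVert_Ioo [Fintype V] {p q : V} {P : G.Walk p q} (hP : P.IsPath) (F : V → ℤ) :
    ∑ i ∈ Ioo 0 P.length, F (P.getVert i) =
      ∑ v, if v ∈ P.support ∧ v ≠ p ∧ v ≠ q then F v else 0 := by
  rw [← sum_filter, ← sum_image (f := F) (g := P.getVert)]
  · refine sum_congr ?_ fun _ _ => rfl
    ext v
    simp only [mem_image, mem_Ioo, mem_filter, mem_univ, true_and]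
    constructor
    · rintro ⟨i, ⟨h0, hi⟩, rfl⟩
      exact ⟨P.getVert_mem_support i, getVert_ne_of_isPath hP h0 hi⟩
    · rintro ⟨hs, h1, h2⟩
      obtain ⟨i, rfl, hi⟩ := Walk.mem_support_iff_exists_getVert.1 hs
      refine ⟨i, ⟨?_, ?_⟩, rfl⟩
      · exact Nat.pos_of_ne_zero fun h => h1 (by simp [h])
      · exact lt_of_le_of_ne hi fun h => h2 (by simp [h])
  · intro i hi j hj h
    simp only [coe_Ioo, Set.mem_Ioo] at hi hj
    exact hP.getVert_injOn (by simp; omega) (by simp; omega) h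

/-- Every vertex is one of `x, y, z` or an internal vertex of exactly one of the paths. -/
lemma Theta2Cond.eq_add_ite (h : Theta2Cond G x y z Q₁ Q₂ R₁ R₂ S) (F : V → ℤ) (v : V) :
    F v = (if v = x then F v else 0) + (if v = y then F v else 0) + (if v = z then F v else 0) +
      (if v ∈ Q₁.support ∧ v ≠ x ∧ v ≠ y then F v else 0) +
      (if v ∈ Q₂.support ∧ v ≠ x ∧ v ≠ y then F v else 0) +
      (if v ∈ R₁.support ∧ v ≠ x ∧ v ≠ z then F v else 0) +
      (if v ∈ R₂.support ∧ v ≠ x ∧ v ≠ z then F v else 0) +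
      (if v ∈ S.support ∧ v ≠ y ∧ v ≠ z then F v else 0) := by
  obtain ⟨hxy, hxz, hyz, -, -, -, -, -, -, -, d1, d2, d3, d4, d5, d6, d7, d8, d9, d10,
    hv, -⟩ := h
  replace hv := hv v
  by_cases hx : v = x
  · subst hx
    have i1 : v ∉ S.support := fun hS => (d4 v Q₁.start_mem_support hS).2.elim hxy hxz
    simp [hxy, hxz, i1]
  by_cases hy : v = y
  · subst hy
    have i1 : v ∉ R₁.support := fun hS => (d2 v Q₁.end_mem_support hS).2.elim hx hyz
    have i2 : v ∉ R₂.support := fun hS => (d3 v Q₁.end_mem_support hS).2.elim hx hyz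
    simp [hx, hyz, i1, i2]
  by_cases hz : v = z
  · subst hz
    have i1 : v ∉ Q₁.support := fun hS => (d2 v hS R₁.end_mem_support).1.elim hx hy
    have i2 : v ∉ Q₂.support := fun hS => (d5 v hS R₁.end_mem_support).1.elim hx hy
    simp [hx, hy, i1, i2]
  replace d1 := d1.not_mem hx hy
  replace d2 := d2.not_mem hx hy
  replace d3 := d3.not_mem hx hy
  replace d4 := d4.not_mem hx hy
  replace d5 := d5.not_mem hx hy
  replace d6 := d6.not_mem hx hy
  replace d7 := d7.not_mem hx hy
  replace d8 := d8.not_mem hx hz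
  replace d9 := d9.not_mem hx hz
  replace d10 := d10.not_mem hx hz
  simp only [hx, hy, hz, ne_eq, not_false_eq_true, and_true, if_false, zero_add]
  by_cases h1 : v ∈ Q₁.support
  · simp [h1, d1 h1, d2 h1, d3 h1, d4 h1]
  by_cases h2 : v ∈ Q₂.support
  · simp [h1, h2, d5 h2, d6 h2, d7 h2]
  by_cases h3 : v ∈ R₁.support
  · simp [h1, h2, h3, d8 h3, d9 h3]
  by_cases h4 : v ∈ R₂.support
  · simp [h1, h2, h3, h4, d10 h4]
  have h5 : v ∈ S.support := by simpa [h1, h2, h3, h4] using hv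
  simp [h1, h2, h3, h4, h5]

lemma Theta2Cond.sum_eq [Fintype V] (h : Theta2Cond G x y z Q₁ Q₂ R₁ R₂ S) (F : V → ℤ) :
    ∑ v, F v = F x + F y + F z + ∑ i ∈ Ioo 0 Q₁.length, F (Q₁.getVert i) +
      ∑ i ∈ Ioo 0 Q₂.length, F (Q₂.getVert i) + ∑ i ∈ Ioo 0 R₁.length, F (R₁.getVert i) +
      ∑ i ∈ Ioo 0 R₂.length, F (R₂.getVert i) + ∑ i ∈ Ioo 0 S.length, F (S.getVert i) := by
  have key := h.eq_add_ite F
  obtain ⟨-, -, -, p1, p2, p3, p4, p5, -⟩ := h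
  have hs : ∀ t, F t = ∑ v, if v = t then F v else 0 := by simp
  rw [sum_getVert_Ioo p1, sum_getVert_Ioo p2, sum_getVert_Ioo p3, sum_getVert_Ioo p4,
    sum_getVert_Ioo p5, hs x, hs y, hs z, sum_congr rfl fun v _ => key v]
  simp only [sum_add_distrib]

end Structure

section PathSums

open Finset

lemma sum_Ioo_eq_of_step {L : ℕ} (hL : 1 ≤ L) (g c : ℕ → ℤ) (h0 : c 0 = 0)
    (h : ∀ i, i + 1 < L → c (i + 1) = c i + g (i + 1)) : ∑ i ∈ Ioo 0 L, g i = c (L - 1) := by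
  obtain ⟨m, rfl⟩ := Nat.exists_eq_add_of_le' hL
  induction m with
  | zero => rw [show Ioo 0 (0 + 1) = (∅ : Finset ℕ) from rfl]; simp [h0]
  | succ k ih =>
    have hI : Ioo 0 (k + 1 + 1) = insert (k + 1) (Ioo 0 (k + 1)) := by
      ext i; simp only [mem_Ioo, mem_insert]; omega
    rw [hI, sum_insert (by simp), ih (by omega) (fun i hi => h i (by omega))]
    have := h k (by omega)
    simp only [Nat.add_sub_cancel] at *
    omega

/-- Shifting the end values `A`, `B` of the profile `i ↦ min (A + i) (B + (L - i))` by
`e`, `f ∈ {-1, 0, 1}` changes the sum over the internal positions by `sig`. -/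
lemma sum_Ioo_eq_sig {L : ℕ} (hL : 1 ≤ L) (A B e f : ℤ) (he : e = -1 ∨ e = 0 ∨ e = 1)
    (hf : f = -1 ∨ f = 0 ∨ f = 1) (h1 : 0 ≤ B - A + L) (h2 : B - A + L ≤ 2 * L)
    (h3 : 0 ≤ B - A + L + f - e) (h4 : B - A + L + f - e ≤ 2 * L) :
    ∑ i ∈ Ioo 0 L, (min (A + e + i) (B + f + (L - i)) - min (A + i) (B + (L - i))) =
      sig L (B - A + L) e f := by
  obtain ⟨t, ht⟩ : ∃ t, t = B - A + L := ⟨_, rfl⟩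
  have hB : B = t + A - L := by omega
  rw [← ht] at *
  subst hB
  rcases he with rfl | rfl | rfl <;> rcases hf with rfl | rfl | rfl
  · rw [sum_Ioo_eq_of_step hL _ (fun m => -m) (by simp) (by intros; omega)]
    simp [sig]; omega
  · rw [sum_Ioo_eq_of_step hL _ (fun m => -min (m : ℤ) (t / 2)) (by omega)
      (by intros; omega)]
    simp [sig]; omega
  · rw [sum_Ioo_eq_of_step hL _ (fun m => -min (m : ℤ) (t / 2) + max 0 (m - (t + 1) / 2))
      (by omega) (by intros; omega)]
    simp [sig]; omega
  · rw [sum_Ioo_eq_of_step hL _ (fun m => -max 0 ((m : ℤ) - (t - 1) / 2)) (by omega)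
      (by intros; omega)]
    simp [sig]; omega
  · rw [sum_Ioo_eq_of_step hL _ (fun _ => 0) (by simp) (by intros; omega)]
    simp [sig]
  · rw [sum_Ioo_eq_of_step hL _ (fun m => max 0 ((m : ℤ) - t / 2)) (by omega)
      (by intros; omega)]
    simp [sig]; omega
  · rw [sum_Ioo_eq_of_step hL _ (fun m => min (m : ℤ) ((t - 2) / 2) - max 0 (m - (t - 1) / 2))
      (by omega) (by intros; omega)]
    simp [sig]; omega
  · rw [sum_Ioo_eq_of_step hL _ (fun m => max 0 (min (m : ℤ) ((t - 1) / 2))) (by omega)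
      (by intros; omega)]
    simp [sig]; omega
  · rw [sum_Ioo_eq_of_step hL _ (fun m => m) (by simp) (by intros; omega)]
    simp [sig]; omega

end PathSums

section Transmission

open SimpleGraph Finset

variable {V : Type*} {G : SimpleGraph V} {x y z : V}
  {Q₁ Q₂ : G.Walk x y} {R₁ R₂ : G.Walk x z} {S : G.Walk y z}

lemma IntDisj.isOff {p q p' q' v : V} {P : G.Walk p q} {Q : G.Walk p' q'} (h : IntDisj P Q)
    (hQ : Q.IsPath) (hv : v ∈ P.support) : IsOff v Q := by
  rintro i h0 hi rfl
  have hne := getVert_ne_of_isPath hQ h0 hi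
  exact (h _ hv (Q.getVert_mem_support i)).2.elim hne.1 hne.2

lemma IsEar.dist_le_add (hG : G.Connected) {p q v : V} {P : G.Walk p q} (hP : IsEar P)
    (hv : IsOff v P) : G.dist v q ≤ G.dist v p + P.length ∧ G.dist v p ≤ G.dist v q + P.length := by
  have h1 := hP.dist_getVert hG hv le_rfl
  have h2 := hP.dist_getVert hG hv (Nat.zero_le _)
  rw [Walk.getVert_length] at h1
  rw [Walk.getVert_zero] at h2
  push_cast at h2
  omega

lemma one_le_length {p q : V} (P : G.Walk p q) (h : p ≠ q) : 1 ≤ P.length :=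
  Nat.one_le_iff_ne_zero.2 fun h0 => h (Walk.eq_of_length_eq_zero h0)

lemma Theta2Cond.exists_adj_snd (h : Theta2Cond G x y z Q₁ Q₂ R₁ R₂ S) {v : V} (hv : v ≠ y) :
    G.dist v y = G.dist v (Q₁.getVert (Q₁.length - 1)) + 1 ∨
      G.dist v y = G.dist v (Q₂.getVert (Q₂.length - 1)) + 1 ∨
      G.dist v y = G.dist v (S.getVert 1) + 1 := by
  obtain ⟨w, hw, hd⟩ := exists_adj_dist_succ h.connected hv
  rcases h.eq_of_adj_snd hw with rfl | rfl | rfl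
  · exact Or.inl hd
  · exact Or.inr (Or.inl hd)
  · exact Or.inr (Or.inr hd)

lemma Theta2Cond.dist_snd_eq (h : Theta2Cond G x y z Q₁ Q₂ R₁ R₂ S) {v : V} (hv : v ≠ y)
    (o₁ : IsOff v Q₁) (o₂ : IsOff v Q₂) (o₃ : IsOff v S) :
    G.dist v y = G.dist v x + Q₁.length ∨ G.dist v y = G.dist v x + Q₂.length ∨
      G.dist v y = G.dist v z + S.length := by
  have h1 := h.isEar_fst.dist_getVert h.connected o₁ (Nat.sub_le _ 1)
  have h2 := h.swap.isEar_fst.dist_getVert h.connected o₂ (Nat.sub_le _ 1)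
  have l1 := one_le_length Q₁ h.1
  have l2 := one_le_length Q₂ h.1
  have l3 := one_le_length S h.2.2.1
  have h3 := h.isEar_link.dist_getVert h.connected o₃ l3
  rcases h.exists_adj_snd hv with h' | h' | h' <;> omega

/-- The distances from `x` to `y` and `z`. -/
lemma Theta2Cond.dist_fst (h : Theta2Cond G x y z Q₁ Q₂ R₁ R₂ S) :
    G.dist x y = min (min Q₁.length Q₂.length) (min R₁.length R₂.length + S.length) := by
  have hG := h.connected
  have k1 := h.isEar_fst
  have k2 := h.swap.isEar_fst
  have k3 := h.flip.isEar_fst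
  have k4 := h.flip.swap.isEar_fst
  have k5 := h.isEar_link
  have h' := h.flip
  have o1 : IsOff x Q₁ := h.swap.2.2.2.2.2.2.2.2.2.2.1.isOff k1.1 Q₂.start_mem_support
  have o2 : IsOff x Q₂ := h.2.2.2.2.2.2.2.2.2.2.1.isOff k2.1 Q₁.start_mem_support
  have o3 : IsOff x R₁ := h'.swap.2.2.2.2.2.2.2.2.2.2.1.isOff k3.1 R₂.start_mem_support
  have o4 : IsOff x R₂ := h'.2.2.2.2.2.2.2.2.2.2.1.isOff k4.1 R₁.start_mem_support
  have o5 : IsOff x S := h.2.2.2.2.2.2.2.2.2.2.2.2.2.1.isOff k5.1 Q₁.start_mem_support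
  have o6 : IsOff x S.reverse :=
    h'.2.2.2.2.2.2.2.2.2.2.2.2.2.1.isOff k5.1.reverse R₁.start_mem_support
  have e1 := h.dist_snd_eq h.1 o1 o2 o5
  have e2 := h'.dist_snd_eq h.2.1 o3 o4 o6
  have b1 := k1.dist_le_add hG o1
  have b2 := k2.dist_le_add hG o2
  have b3 := k3.dist_le_add hG o3
  have b4 := k4.dist_le_add hG o4
  have b5 := k5.dist_le_add hG o5
  have l1 := one_le_length S h.2.2.1
  simp only [SimpleGraph.dist_self, Walk.length_reverse] at *
  omega

lemma Theta2Cond.isOff_of_mem_fst (h : Theta2Cond G x y z Q₁ Q₂ R₁ R₂ S) {v : V}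
    (hv : v ∈ Q₁.support) : IsOff v Q₂ ∧ IsOff v R₁ ∧ IsOff v R₂ ∧ IsOff v S := by
  obtain ⟨-, -, -, -, p2, p3, p4, p5, -, -, d1, d2, d3, d4, -⟩ := h
  exact ⟨d1.isOff p2 hv, d2.isOff p3 hv, d3.isOff p4 hv, d4.isOff p5 hv⟩

lemma IsOff.reverse {p q v : V} {P : G.Walk p q} (h : IsOff v P) : IsOff v P.reverse := by
  intro i h0 hi
  rw [Walk.length_reverse] at hi
  rw [Walk.getVert_reverse]
  exact h _ (by omega) (by omega)

/-- The distances from the first internal vertex of `Q₁` to `x`, `y` and `z`. -/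
lemma Theta2Cond.dist_getVert_one (h : Theta2Cond G x y z Q₁ Q₂ R₁ R₂ S) :
    G.dist (Q₁.getVert 1) x = 1 ∧
    (G.dist (Q₁.getVert 1) y : ℤ) = G.dist x y + min 1 ((Q₁.length : ℤ) - 1 - G.dist x y) ∧
    (G.dist (Q₁.getVert 1) z : ℤ) =
      G.dist x z + min 1 ((Q₁.length : ℤ) - 1 + S.length - G.dist x z) := by
  have hG := h.connected
  have k1 := h.isEar_fst
  have k2 := h.swap.isEar_fst
  have k3 := h.flip.isEar_fst
  have k4 := h.flip.swap.isEar_fst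
  have k5 := h.isEar_link
  have l1 := one_le_length Q₁ h.1
  have l2 := one_le_length Q₂ h.1
  have l3 := one_le_length R₁ h.2.1
  have l4 := one_le_length R₂ h.2.1
  have l5 := one_le_length S h.2.2.1
  have dy := h.dist_fst
  have dz := h.flip.dist_fst
  obtain ⟨o2, o3, o4, o5⟩ := h.isOff_of_mem_fst (Q₁.getVert_mem_support 1)
  have b2 := k2.dist_le_add hG o2
  have b3 := k3.dist_le_add hG o3
  have b4 := k4.dist_le_add hG o4
  have b5 := k5.dist_le_add hG o5
  have hx : G.dist (Q₁.getVert 1) x = 1 := by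
    have := Q₁.adj_getVert_succ l1
    rw [Walk.getVert_zero, zero_add] at this
    exact dist_eq_one_iff_adj.2 this.symm
  have hz : Q₁.getVert 1 ≠ z := fun hz => by
    have := h.2.2.2.2.2.2.2.2.2.2.2.1 z (hz ▸ Q₁.getVert_mem_support 1) R₁.end_mem_support
    exact this.1.elim h.2.1.symm h.2.2.1.symm
  have ez := h.flip.dist_snd_eq hz o3 o4 o5.reverse
  rw [Walk.length_reverse] at ez dz
  refine ⟨hx, ?_⟩
  rcases l1.eq_or_lt with h1 | h1
  · have hy : Q₁.getVert 1 = y := by rw [h1, Walk.getVert_length]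
    rw [hy] at hx b3 b4 b5 ez ⊢
    simp only [SimpleGraph.dist_self] at b3 b4 b5 ez ⊢
    omega
  · have hy : Q₁.getVert 1 ≠ y := (getVert_ne_of_isPath k1.1 one_pos h1).2
    have m1 := k1.dist_snd_getVert hG l1 le_rfl
    have m2 := k1.dist_snd_getVert hG (i := Q₁.length - 1) (by omega) (by omega)
    rw [Walk.getVert_length] at m1
    have m3 := k2.dist_getVert hG o2 (Nat.sub_le _ 1)
    have m5 := k5.dist_getVert hG o5 l5
    have ey := h.exists_adj_snd hy
    have ey' : G.dist (Q₁.getVert 1) y = Q₁.length - 1 ∨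
        G.dist (Q₁.getVert 1) y = 1 + Q₂.length ∨
        G.dist (Q₁.getVert 1) y = G.dist (Q₁.getVert 1) z + S.length := by
      rcases ey with ey | ey | ey <;> omega
    have u1 : G.dist (Q₁.getVert 1) y ≤ Q₁.length - 1 := by omega
    have eb : G.dist (Q₁.getVert 1) z = 1 + min R₁.length R₂.length ∨
        G.dist (Q₁.getVert 1) z = G.dist (Q₁.getVert 1) y + S.length := by omega
    clear ey m1 m2 m3 m5 ez
    have u2 : G.dist (Q₁.getVert 1) z ≤ 1 + min R₁.length R₂.length := by omega
    clear b3 b4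
    generalize min R₁.length R₂.length = b at *
    rw [dy, dz]
    rcases ey' with e | e | e <;> rcases eb with e' | e' <;> constructor <;> omega

/-- The sum of the distances from `v`. -/
noncomputable def transmission [Fintype V] (G : SimpleGraph V) (v : V) : ℤ :=
  ∑ w, (G.dist v w : ℤ)

/-- Along an ear avoiding `u` and `v`, the difference of the distances to `u` and `v` sums up
to `sig`. -/
lemma IsEar.sum_dist_sub (hG : G.Connected) {p q u v : V} {P : G.Walk p q} (hP : IsEar P)
    (hpq : p ≠ q) (hu : IsOff u P) (hv : IsOff v P) (e f : ℤ)
    (he : (G.dist u p : ℤ) = G.dist v p + e) (hf : (G.dist u q : ℤ) = G.dist v q + f)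
    (he' : -1 ≤ e ∧ e ≤ 1) (hf' : -1 ≤ f ∧ f ≤ 1) :
    ∑ i ∈ Ioo 0 P.length, ((G.dist u (P.getVert i) : ℤ) - G.dist v (P.getVert i)) =
      sig P.length (G.dist v q - G.dist v p + P.length) e f := by
  have b1 := hP.dist_le_add hG hu
  have b2 := hP.dist_le_add hG hv
  rw [← sum_Ioo_eq_sig (one_le_length P hpq) (G.dist v p) (G.dist v q) e f (by omega) (by omega)
    (by omega) (by omega) (by omega) (by omega)]
  refine sum_congr rfl fun i hi => ?_
  have hi' := (mem_Ioo.1 hi).2.le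
  rw [hP.dist_getVert hG hu hi', hP.dist_getVert hG hv hi', he, hf]

/-- The sum of the differences of the distances to `P.getVert 1` and `p` along `P` itself. -/
lemma IsEar.sum_dist_snd_sub (hG : G.Connected) {p q : V} {P : G.Walk p q} (hP : IsEar P)
    (hpq : p ≠ q) (hp : IsOff p P) (f : ℤ)
    (hf : (G.dist (P.getVert 1) q : ℤ) = G.dist p q + f)
    (hf' : f = min 1 ((P.length : ℤ) - 1 - G.dist p q)) :
    ∑ i ∈ Ioo 0 P.length, ((G.dist (P.getVert 1) (P.getVert i) : ℤ) - G.dist p (P.getVert i)) =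
      - G.dist p q - f := by
  have b := hP.dist_le_add hG hp
  have hd := hG.pos_dist_of_ne hpq
  have l := one_le_length P hpq
  rw [SimpleGraph.dist_self] at b
  have key := sum_Ioo_eq_sig l 0 (G.dist p q) (-1) f (by omega) (by omega)
    (by omega) (by omega) (by omega) (by omega)
  have hs : sig P.length (G.dist p q - 0 + P.length) (-1) f = - G.dist p q - f := by
    rcases (show f = -1 ∨ f = 0 ∨ f = 1 by omega) with h | h | h <;> subst h <;>
      simp [sig] <;> omega
  rw [← hs, ← key]
  refine sum_congr rfl fun i hi => ?_
  have hi' := mem_Ioo.1 hi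
  rw [hP.dist_snd_getVert hG hi'.1 hi'.2.le, hP.dist_getVert hG hp hi'.2.le, hf,
    SimpleGraph.dist_self]
  push_cast
  congr 2

lemma Theta2Cond.transmission_sub_eq_bal [Fintype V] (h : Theta2Cond G x y z Q₁ Q₂ R₁ R₂ S) :
    transmission G (Q₁.getVert 1) - transmission G x =
      bal Q₂.length R₁.length R₂.length S.length (G.dist x y) (G.dist x z)
        (min 1 ((Q₁.length : ℤ) - 1 - G.dist x y))
        (min 1 ((Q₁.length : ℤ) - 1 + S.length - G.dist x z)) := by
  have hG := h.connected
  obtain ⟨dx, dy, dz⟩ := h.dist_getVert_one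
  obtain ⟨o2, o3, o4, o5⟩ := h.isOff_of_mem_fst (Q₁.getVert_mem_support 1)
  obtain ⟨q2, q3, q4, q5⟩ := h.isOff_of_mem_fst Q₁.start_mem_support
  obtain ⟨q1, -⟩ := h.swap.isOff_of_mem_fst Q₂.start_mem_support
  have by1 := h.dist_fst
  have bz1 := h.flip.dist_fst
  rw [Walk.length_reverse] at bz1
  have l1 := one_le_length Q₁ h.1
  have l2 := one_le_length R₁ h.2.1
  have l3 := one_le_length R₂ h.2.1
  have l4 := one_le_length S h.2.2.1
  obtain ⟨e, he⟩ : ∃ e : ℤ, e = min 1 ((Q₁.length : ℤ) - 1 - G.dist x y) := ⟨_, rfl⟩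
  obtain ⟨f, hf⟩ : ∃ f : ℤ, f = min 1 ((Q₁.length : ℤ) - 1 + S.length - G.dist x z) := ⟨_, rfl⟩
  rw [← he] at dy
  rw [← hf] at dz
  have s1 := h.isEar_fst.sum_dist_snd_sub hG h.1 q1 e dy he
  have dx' : (G.dist (Q₁.getVert 1) x : ℤ) = G.dist x x + 1 := by
    rw [SimpleGraph.dist_self, dx]; rfl
  have he' : -1 ≤ e ∧ e ≤ 1 := by omega
  have hf' : -1 ≤ f ∧ f ≤ 1 := by omega
  have s2 := h.swap.isEar_fst.sum_dist_sub hG h.1 o2 q2 1 e dx' dy (by omega) he'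
  have s3 := h.flip.isEar_fst.sum_dist_sub hG h.2.1 o3 q3 1 f dx' dz (by omega) hf'
  have s4 := h.flip.swap.isEar_fst.sum_dist_sub hG h.2.1 o4 q4 1 f dx' dz (by omega) hf'
  have s5 := h.isEar_link.sum_dist_sub hG h.2.2.1 o5 q5 e f dy dz he' hf'
  rw [transmission, transmission, ← sum_sub_distrib,
    h.sum_eq fun w => (G.dist (Q₁.getVert 1) w : ℤ) - G.dist x w, s1, s2, s3, s4, s5, dx', dy, dz,
    ← he, ← hf, bal]
  simp only [SimpleGraph.dist_self]
  push_cast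
  ring_nf

lemma getVert_one_ne_start {p q : V} {P : G.Walk p q} (hP : P.IsPath) (h : p ≠ q) :
    P.getVert 1 ≠ p := fun h' => by
  have := (hP.getVert_eq_start_iff (one_le_length P h)).1 h'
  omega

lemma Theta2Cond.getVert_one_ne_link (h : Theta2Cond G x y z Q₁ Q₂ R₁ R₂ S) :
    Q₁.getVert 1 ≠ R₁.getVert 1 := fun he => by
  have hd := h.2.2.2.2.2.2.2.2.2.2.2.1 (Q₁.getVert 1) (Q₁.getVert_mem_support 1)
    (he ▸ R₁.getVert_mem_support 1)
  have hx := getVert_one_ne_start h.isEar_fst.1 h.1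
  exact h.2.2.1 ((hd.1.resolve_left hx).symm.trans (hd.2.resolve_left hx))

lemma Theta2Cond.two_le_length_or (h : Theta2Cond G x y z Q₁ Q₂ R₁ R₂ S) :
    2 ≤ Q₁.length ∨ 2 ≤ Q₂.length := by
  by_contra! hc
  have l1 := one_le_length Q₁ h.1
  have l2 := one_le_length Q₂ h.1
  refine h.2.2.2.2.2.2.2.2.1 (Walk.ext_getVert_le_length (by omega) fun k hk => ?_)
  rcases Nat.le_one_iff_eq_zero_or_eq_one.1 (show k ≤ 1 by omega) with rfl | rfl
  · simp
  · rw [Q₁.getVert_of_length_le (by omega), Q₂.getVert_of_length_le (by omega)]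

lemma Theta2Cond.getVert_one_ne (h : Theta2Cond G x y z Q₁ Q₂ R₁ R₂ S) :
    Q₁.getVert 1 ≠ Q₂.getVert 1 := fun he => by
  have p1 := h.isEar_fst.1
  have p2 := h.swap.isEar_fst.1
  have hd := h.2.2.2.2.2.2.2.2.2.2.1 (Q₁.getVert 1) (Q₁.getVert_mem_support 1)
    (he ▸ Q₂.getVert_mem_support 1)
  have hy := hd.1.resolve_left (getVert_one_ne_start p1 h.1)
  have l1 := (p1.getVert_eq_end_iff (one_le_length Q₁ h.1)).1 hy
  have l2 := (p2.getVert_eq_end_iff (one_le_length Q₂ h.1)).1 (he ▸ hy)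
  rcases h.two_le_length_or with h' | h' <;> omega

lemma adj_getVert_one {p q : V} (P : G.Walk p q) (h : p ≠ q) : G.Adj p (P.getVert 1) := by
  simpa using P.adj_getVert_succ (one_le_length P h)

/-- With four paths of length two and a long path `S`, the first edge of `S` is unbalanced. -/
lemma Theta2Cond.transmission_link_sub [Fintype V] (h : Theta2Cond G x y z Q₁ Q₂ R₁ R₂ S)
    (h1 : Q₁.length = 2) (h2 : Q₂.length = 2) (h3 : R₁.length = 2) (h4 : R₂.length = 2)
    (h5 : 6 ≤ S.length) : transmission G (S.getVert 1) - transmission G y = 2 := by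
  have hG := h.connected
  have hyz : y ≠ z := h.2.2.1
  have k1 := h.isEar_fst
  have k2 := h.swap.isEar_fst
  have k3 := h.flip.isEar_fst
  have k4 := h.flip.swap.isEar_fst
  have k5 := h.isEar_link
  obtain ⟨q2, q3, q4, q5⟩ := h.isOff_of_mem_fst Q₁.end_mem_support
  obtain ⟨q1, -⟩ := h.swap.isOff_of_mem_fst Q₂.end_mem_support
  have hS := S.getVert_mem_support 1
  have ⟨o1, o2, o3, o4⟩ : IsOff (S.getVert 1) Q₁ ∧ IsOff (S.getVert 1) Q₂ ∧
      IsOff (S.getVert 1) R₁ ∧ IsOff (S.getVert 1) R₂ := by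
    obtain ⟨-, -, -, p1, p2, p3, p4, p5, -, -, -, -, -, d4, -, -, d7, -, d9, d10, -⟩ := h
    exact ⟨d4.symm.isOff p1 hS, d7.symm.isOff p2 hS, d9.symm.isOff p3 hS, d10.symm.isOff p4 hS⟩
  have yx : G.dist y x = 2 := by
    have := h.dist_fst
    rw [SimpleGraph.dist_comm]
    omega
  have yz : G.dist y z = 4 := by
    have e := h.flip.dist_snd_eq hyz q3 q4 q5.reverse
    rw [SimpleGraph.dist_self, Walk.length_reverse] at e
    have b := k3.dist_le_add hG q3
    omega
  have sy : G.dist (S.getVert 1) y = 1 := dist_eq_one_iff_adj.2 (adj_getVert_one S hyz).symm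
  have hsx : S.getVert 1 ≠ x := fun hx => by
    have := h.2.2.2.2.2.2.2.2.2.2.2.2.2.1 x Q₁.start_mem_support (hx ▸ hS)
    exact this.2.elim h.1 h.2.1
  have b1 := k1.dist_le_add hG o1
  have b3 := k3.dist_le_add hG o3
  have sx' : G.dist (S.getVert 1) x = 3 ∨
      G.dist (S.getVert 1) x = G.dist (S.getVert 1) z + 2 := by
    obtain ⟨w, hw, hd⟩ := exists_adj_dist_succ hG hsx
    have e1 := k1.dist_getVert hG o1 (i := 1) (by omega)
    have e2 := k2.dist_getVert hG o2 (i := 1) (by omega)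
    have e3 := k3.dist_getVert hG o3 (i := 1) (by omega)
    have e4 := k4.dist_getVert hG o4 (i := 1) (by omega)
    rcases h.eq_of_adj_fst hw with rfl | rfl | rfl | rfl <;> omega
  have hs : 1 < S.length := by omega
  have sz' : G.dist (S.getVert 1) z = S.length - 1 ∨
      G.dist (S.getVert 1) z = G.dist (S.getVert 1) x + 2 := by
    have e3 := k3.dist_getVert hG o3 (Nat.sub_le _ 1)
    have e4 := k4.dist_getVert hG o4 (Nat.sub_le _ 1)
    have e5 := k5.dist_snd_getVert hG (i := S.length - 1) (by omega) (by omega)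
    rcases h.flip.exists_adj_snd (getVert_ne_of_isPath k5.1 one_pos hs).2 with e | e | e
    · omega
    · omega
    · rw [Walk.getVert_reverse] at e
      omega
  have sx : G.dist (S.getVert 1) x = 3 := by omega
  have sz : G.dist (S.getVert 1) z = 5 := by omega
  have s5 := k5.sum_dist_snd_sub hG hyz q5 1 (by omega) (by omega)
  have yy := SimpleGraph.dist_self (G := G) (v := y)
  have s1 := k1.sum_dist_sub hG h.1 o1 q1 1 1 (by omega) (by omega) (by omega) (by omega)
  have s2 := k2.sum_dist_sub hG h.1 o2 q2 1 1 (by omega) (by omega) (by omega) (by omega)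
  have s3 := k3.sum_dist_sub hG h.2.1 o3 q3 1 1 (by omega) (by omega) (by omega) (by omega)
  have s4 := k4.sum_dist_sub hG h.2.1 o4 q4 1 1 (by omega) (by omega) (by omega) (by omega)
  rw [transmission, transmission, ← sum_sub_distrib,
    h.sum_eq fun w => (G.dist (S.getVert 1) w : ℤ) - G.dist y w, s1, s2, s3, s4, s5, sx, sy, sz,
    yx, yz, yy, h1, h2, h3, h4]
  simp [sig]

/-- The four edges at `x`. -/
lemma Theta2Cond.sum_edges_fst (h : Theta2Cond G x y z Q₁ Q₂ R₁ R₂ S) (F : Sym2 V → ℚ) :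
    ∑ e ∈ ({s(x, Q₁.getVert 1), s(x, Q₂.getVert 1), s(x, R₁.getVert 1), s(x, R₂.getVert 1)} :
        Finset (Sym2 V)), F e =
      F s(x, Q₁.getVert 1) + F s(x, Q₂.getVert 1) + F s(x, R₁.getVert 1) +
        F s(x, R₂.getVert 1) := by
  have n1 := h.getVert_one_ne
  have n2 := h.getVert_one_ne_link
  have n3 := h.flip.swap.flip.getVert_one_ne_link
  have n4 := h.swap.getVert_one_ne_link
  have n5 := h.swap.flip.swap.flip.getVert_one_ne_link
  have n6 := h.flip.getVert_one_ne
  rw [sum_insert, sum_insert, sum_insert, sum_singleton]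
  · ring
  all_goals simp only [mem_insert, mem_singleton, Sym2.eq_iff]; grind

end Transmission

section Szeged

open SimpleGraph Finset

variable {V : Type*} [Fintype V] {G : SimpleGraph V}

lemma nC_add_nC_add_nE (G : SimpleGraph V) (u v : V) :
    nC G u v + nC G v u + nE G u v = Fintype.card V := by
  rw [Fintype.card, card_eq_sum_ones]
  simp only [nC, nE, card_filter, ← sum_add_distrib]
  refine sum_congr rfl fun w _ => ?_
  split_ifs <;> omega

lemma transmission_sub_eq (hG : G.Connected) {u v : V} (h : G.Adj u v) :
    transmission G v - transmission G u = nC G u v - nC G v u := by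
  simp only [nC, card_filter, transmission, Nat.cast_sum, ← sum_sub_distrib]
  refine sum_congr rfl fun w _ => ?_
  have := dist_adj_le hG w h
  rw [G.dist_comm (u := w), G.dist_comm (u := w)] at this
  split_ifs <;> omega

lemma szContrib_of_adj (hG : G.Connected) {u v : V} (h : G.Adj u v) :
    szContrib G s(u, v) =
      ((Fintype.card V : ℚ) ^ 2 - ((transmission G v - transmission G u : ℤ) : ℚ) ^ 2) / 4 := by
  rw [transmission_sub_eq hG h, ← nC_add_nC_add_nE G u v]
  simp only [szContrib, Sym2.lift_mk]
  push_cast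
  ring

lemma szContrib_le (hG : G.Connected) {e : Sym2 V} (he : e ∈ G.edgeFinset) :
    szContrib G e ≤ (Fintype.card V : ℚ) ^ 2 / 4 := by
  induction e using Sym2.inductionOn with
  | _ u v =>
    rw [szContrib_of_adj hG (by simpa using he)]
    gcongr
    exact sub_le_self _ (sq_nonneg _)

lemma revSz_le_sub (hG : G.Connected) {T : Finset (Sym2 V)} (hT : T ⊆ G.edgeFinset) :
    revSz G ≤ (G.edgeFinset.card : ℚ) * ((Fintype.card V : ℚ) ^ 2 / 4) -
      ∑ e ∈ T, ((Fintype.card V : ℚ) ^ 2 / 4 - szContrib G e) := by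
  have := sum_le_sum_of_subset_of_nonneg
    (f := fun e => (Fintype.card V : ℚ) ^ 2 / 4 - szContrib G e) hT
    fun e he _ => sub_nonneg.2 (szContrib_le hG he)
  rw [revSz]
  simp only [sum_sub_distrib, sum_const, nsmul_eq_mul] at this ⊢
  linarith

variable {x y z : V} {Q₁ Q₂ : G.Walk x y} {R₁ R₂ : G.Walk x z} {S : G.Walk y z}

lemma Theta2Cond.card_add_two (h : Theta2Cond G x y z Q₁ Q₂ R₁ R₂ S) :
    Fintype.card V + 2 = Q₁.length + Q₂.length + R₁.length + R₂.length + S.length := by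
  have key := h.sum_eq fun _ => 1
  simp only [sum_const, card_univ, Nat.card_Ioo, nsmul_eq_mul, mul_one] at key
  have l1 := one_le_length Q₁ h.1
  have l2 := one_le_length Q₂ h.1
  have l3 := one_le_length R₁ h.2.1
  have l4 := one_le_length R₂ h.2.1
  have l5 := one_le_length S h.2.2.1
  omega

lemma Theta2Cond.card_edgeFinset_le (h : Theta2Cond G x y z Q₁ Q₂ R₁ R₂ S) :
    G.edgeFinset.card ≤ Fintype.card V + 2 := by
  have hsub : G.edgeFinset ⊆
      (Q₁.edges ++ Q₂.edges ++ R₁.edges ++ R₂.edges ++ S.edges).toFinset := fun e he => by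
    have := h.2.2.2.2.2.2.2.2.2.2.2.2.2.2.2.2.2.2.2.2.2 e (mem_edgeFinset.1 he)
    simp only [List.mem_toFinset, List.mem_append]
    tauto
  calc
    _ ≤ _ := card_le_card hsub
    _ ≤ _ := List.toFinset_card_le _
    _ = _ := by simp only [List.length_append, Walk.length_edges]; rw [h.card_add_two]

/-- If the squared imbalances over some set of edges sum up to more than `18`, then the revised
Szeged index is small. -/
lemma Theta2Cond.revSz_lt (h : Theta2Cond G x y z Q₁ Q₂ R₁ R₂ S) {T : Finset (Sym2 V)}
    (hT : T ⊆ G.edgeFinset)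
    (hs : 18 / 4 < ∑ e ∈ T, ((Fintype.card V : ℚ) ^ 2 / 4 - szContrib G e)) :
    revSz G < ((Fintype.card V : ℚ) ^ 3 + 2 * (Fintype.card V : ℚ) ^ 2 - 18) / 4 := by
  have h1 := revSz_le_sub h.connected hT
  have h2 : (G.edgeFinset.card : ℚ) ≤ Fintype.card V + 2 := mod_cast h.card_edgeFinset_le
  have h3 := mul_le_mul_of_nonneg_right h2
    (show 0 ≤ (Fintype.card V : ℚ) ^ 2 / 4 by positivity)
  nlinarith

lemma Theta2Cond.edges_fst_subset (h : Theta2Cond G x y z Q₁ Q₂ R₁ R₂ S) :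
    ({s(x, Q₁.getVert 1), s(x, Q₂.getVert 1), s(x, R₁.getVert 1), s(x, R₂.getVert 1)} :
      Finset (Sym2 V)) ⊆ G.edgeFinset := by
  have a1 := adj_getVert_one Q₁ h.1
  have a2 := adj_getVert_one Q₂ h.1
  have a3 := adj_getVert_one R₁ h.2.1
  have a4 := adj_getVert_one R₂ h.2.1
  simp [insert_subset_iff, a1, a2, a3, a4]

lemma Theta2Cond.sub_szContrib (h : Theta2Cond G x y z Q₁ Q₂ R₁ R₂ S) {u v : V}
    (ha : G.Adj u v) : (Fintype.card V : ℚ) ^ 2 / 4 - szContrib G s(u, v) =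
      ((transmission G v - transmission G u : ℤ) : ℚ) ^ 2 / 4 := by
  rw [szContrib_of_adj h.connected ha]
  ring

lemma Theta2Cond.revSz_lt_of_nine_le (h : Theta2Cond G x y z Q₁ Q₂ R₁ R₂ S)
    (hs : 9 ≤ (transmission G (Q₁.getVert 1) - transmission G x) +
      (transmission G (Q₂.getVert 1) - transmission G x) +
      (transmission G (R₁.getVert 1) - transmission G x) +
      (transmission G (R₂.getVert 1) - transmission G x)) :
    revSz G < ((Fintype.card V : ℚ) ^ 3 + 2 * (Fintype.card V : ℚ) ^ 2 - 18) / 4 := by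
  refine h.revSz_lt h.edges_fst_subset ?_
  rw [h.sum_edges_fst, h.sub_szContrib (adj_getVert_one Q₁ h.1),
    h.sub_szContrib (adj_getVert_one Q₂ h.1), h.sub_szContrib (adj_getVert_one R₁ h.2.1),
    h.sub_szContrib (adj_getVert_one R₂ h.2.1)]
  generalize transmission G (Q₁.getVert 1) - transmission G x = a at *
  generalize transmission G (Q₂.getVert 1) - transmission G x = b at *
  generalize transmission G (R₁.getVert 1) - transmission G x = c at *
  generalize transmission G (R₂.getVert 1) - transmission G x = d at *
  have hs' : (9 : ℚ) ≤ a + b + c + d := mod_cast hs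
  nlinarith [sq_nonneg ((a : ℚ) - 9 / 4), sq_nonneg ((b : ℚ) - 9 / 4),
    sq_nonneg ((c : ℚ) - 9 / 4), sq_nonneg ((d : ℚ) - 9 / 4)]

lemma Theta2Cond.transmission_sub_eq_two (h : Theta2Cond G x y z Q₁ Q₂ R₁ R₂ S)
    (h1 : Q₁.length = 2) (h2 : Q₂.length = 2) (h3 : R₁.length = 2) (h4 : R₂.length = 2)
    (h5 : 6 ≤ S.length) : transmission G (Q₁.getVert 1) - transmission G x = 2 := by
  have dy := h.dist_fst
  have dz := h.flip.dist_fst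
  rw [Walk.length_reverse] at dz
  rw [h1, h2, h3, h4] at dy dz
  rw [h.transmission_sub_eq_bal, show G.dist x y = 2 by omega, show G.dist x z = 2 by omega, h1, h2,
    h3, h4, show min 1 (((2 : ℕ) : ℤ) - 1 - (2 : ℕ)) = -1 by omega,
    show min 1 (((2 : ℕ) : ℤ) - 1 + S.length - (2 : ℕ)) = 1 by omega]
  simp [bal, sig]

lemma Theta2Cond.revSz_lt_of_length_eq_two (h : Theta2Cond G x y z Q₁ Q₂ R₁ R₂ S)
    (h1 : Q₁.length = 2) (h2 : Q₂.length = 2) (h3 : R₁.length = 2) (h4 : R₂.length = 2)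
    (h5 : 6 ≤ S.length) :
    revSz G < ((Fintype.card V : ℚ) ^ 3 + 2 * (Fintype.card V : ℚ) ^ 2 - 18) / 4 := by
  have hS := adj_getVert_one S h.2.2.1
  have hx : S.getVert 1 ≠ x := fun hx => by
    have := h.2.2.2.2.2.2.2.2.2.2.2.2.2.1 x Q₁.start_mem_support (hx ▸ S.getVert_mem_support 1)
    exact this.2.elim h.1 h.2.1
  refine h.revSz_lt (insert_subset (mem_edgeFinset.2 (G.mem_edgeSet.2 hS)) h.edges_fst_subset) ?_
  have h5' : 6 ≤ S.reverse.length := by rwa [Walk.length_reverse]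
  rw [sum_insert, h.sum_edges_fst, h.sub_szContrib (adj_getVert_one Q₁ h.1),
    h.sub_szContrib (adj_getVert_one Q₂ h.1), h.sub_szContrib (adj_getVert_one R₁ h.2.1),
    h.sub_szContrib (adj_getVert_one R₂ h.2.1), h.sub_szContrib hS,
    h.transmission_link_sub h1 h2 h3 h4 h5, h.transmission_sub_eq_two h1 h2 h3 h4 h5,
    h.swap.transmission_sub_eq_two h2 h1 h3 h4 h5, h.flip.transmission_sub_eq_two h3 h4 h1 h2 h5',
    h.flip.swap.transmission_sub_eq_two h4 h3 h1 h2 h5']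
  · norm_num
  · have hxy := h.1
    simp only [mem_insert, mem_singleton, Sym2.eq_iff]
    grind

lemma Theta2Cond.revSz_lt_of_length_le (h : Theta2Cond G x y z Q₁ Q₂ R₁ R₂ S)
    (hQ : Q₁.length ≤ Q₂.length) (hR : R₁.length ≤ R₂.length) (hn : 12 ≤ Fintype.card V) :
    revSz G < ((Fintype.card V : ℚ) ^ 3 + 2 * (Fintype.card V : ℚ) ^ 2 - 18) / 4 := by
  have hc := h.card_add_two
  have l1 := one_le_length Q₁ h.1
  have l2 : 2 ≤ Q₂.length := by rcases h.two_le_length_or with h' | h' <;> omega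
  have l3 := one_le_length R₁ h.2.1
  have l4 : 2 ≤ R₂.length := by rcases h.flip.two_le_length_or with h' | h' <;> omega
  have l5 := one_le_length S h.2.2.1
  by_cases h2 : Q₁.length = 2 ∧ Q₂.length = 2 ∧ R₁.length = 2 ∧ R₂.length = 2
  · obtain ⟨e1, e2, e3, e4⟩ := h2
    exact h.revSz_lt_of_length_eq_two e1 e2 e3 e4 (by omega)
  apply h.revSz_lt_of_nine_le
  have dy := h.dist_fst
  have dz := h.flip.dist_fst
  rw [h.transmission_sub_eq_bal, h.swap.transmission_sub_eq_bal, h.flip.transmission_sub_eq_bal,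
    h.flip.swap.transmission_sub_eq_bal]
  rw [Walk.length_reverse] at *
  generalize G.dist x y = p at *
  generalize G.dist x z = q at *
  generalize Q₁.length = a at *
  generalize Q₂.length = a' at *
  generalize R₁.length = b at *
  generalize R₂.length = b' at *
  generalize S.length = c at *
  rcases lt_or_ge (b + c) a with h1 | h1
  · obtain rfl : p = b + c := by omega
    obtain rfl : q = b := by omega
    have := nine_le_bal_of_shortcut (a := a) (a' := a') (b := q) (b' := b') (c := c) (by omega)
      (by omega) (by omega) (by omega) (by omega) (by omega) (by omega)
    rw [show ((q : ℤ) - 1 - q) = -1 by omega, show min 1 (-1 : ℤ) = -1 by omega]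
    push_cast
    linarith
  rcases lt_or_ge (a + c) b with h3 | h3
  · obtain rfl : p = a := by omega
    obtain rfl : q = p + c := by omega
    have := nine_le_bal_of_shortcut (a := b) (a' := b') (b := p) (b' := a') (c := c) (by omega)
      (by omega) (by omega) (by omega) (by omega) (by omega) (by omega)
    rw [show ((p : ℤ) - 1 - p) = -1 by omega, show min 1 (-1 : ℤ) = -1 by omega]
    push_cast
    linarith
  · obtain rfl : p = a := by omega
    obtain rfl : q = b := by omega
    have := nine_le_bal_of_balanced (a := p) (a' := a') (b := q) (b' := b') (c := c) (by omega)
      (by omega) (by omega) (by omega) (by omega) (by omega) (by omega) (by omega) (by omega)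
      (by omega) (by omega)
    rw [show ((p : ℤ) - 1 - p) = -1 by omega, show ((q : ℤ) - 1 - q) = -1 by omega,
      show min 1 (-1 : ℤ) = -1 by omega]
    exact this

lemma Theta2Cond.revSz_lt_of_card (h : Theta2Cond G x y z Q₁ Q₂ R₁ R₂ S)
    (hn : 12 ≤ Fintype.card V) :
    revSz G < ((Fintype.card V : ℚ) ^ 3 + 2 * (Fintype.card V : ℚ) ^ 2 - 18) / 4 := by
  rcases le_total Q₁.length Q₂.length with hQ | hQ <;>
    rcases le_total R₁.length R₂.length with hR | hR
  · exact h.revSz_lt_of_length_le hQ hR hn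
  · exact h.flip.swap.flip.revSz_lt_of_length_le hQ hR hn
  · exact h.swap.revSz_lt_of_length_le hQ hR hn
  · exact h.swap.flip.swap.flip.revSz_lt_of_length_le hQ hR hn

end Szeged

/-- A Θ₂-graph of order `n ≥ 12` has revised Szeged index less than
`(n³ + 2n² − 18)/4`. -/
theorem revSz_lt_of_isTheta2 {V : Type*} [Fintype V] (G : SimpleGraph V)
    (hΘ : IsTheta2 G) (hn : 12 ≤ Fintype.card V) :
    revSz G < ((Fintype.card V : ℚ) ^ 3 + 2 * (Fintype.card V : ℚ) ^ 2 - 18) / 4 := by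
  obtain ⟨x, y, z, Q₁, Q₂, R₁, R₂, S, h⟩ := hΘ
  exact h.revSz_lt_of_card hn
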